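/- Let s, t ∈ ℝ with s ≤ N/2 - 1 and μ > 0. Then there exists C > 0 such that ‖Ṫ_u v‖_{Ḃ^{s+t-N/2}_{2,1}} ≤ C ‖u‖_{B̃_μ^{s,1}} ‖v‖_{B̃_μ^{t,∞}}. -/

import Mathlib

open MeasureTheory FourierTransform Real ENNReal

/-- Homogeneous Littlewood–Paley block `Δ̇_q f`, realized with the sharp
frequency cut-off to the dyadic annulus `2^q ≤ |ξ| < 2^{q+1}` (which gives an
equivalent norm for `L²`-based Besov spaces). -/
noncomputable def lpBlock (N : ℕ) (q : ℤ) (f : EuclideanSpace ℝ (Fin N) → ℂ) :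
    EuclideanSpace ℝ (Fin N) → ℂ :=
  𝓕⁻ (fun ξ => if (2:ℝ) ^ q ≤ ‖ξ‖ ∧ ‖ξ‖ < (2:ℝ) ^ (q + 1) then 𝓕 f ξ else 0)

/-- Low-frequency cut-off `Ṡ_{q-1} f` (frequencies `|ξ| < 2^{q-1}`). -/
noncomputable def lowFreq (N : ℕ) (q : ℤ) (f : EuclideanSpace ℝ (Fin N) → ℂ) :
    EuclideanSpace ℝ (Fin N) → ℂ :=
  𝓕⁻ (fun ξ => if ‖ξ‖ < (2:ℝ) ^ (q - 1) then 𝓕 f ξ else 0)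

/-- Homogeneous Besov norm `‖f‖_{Ḃ^s_{2,1}} = Σ_q 2^{qs} ‖Δ̇_q f‖_{L²}`. -/
noncomputable def besovNorm (N : ℕ) (s : ℝ) (f : EuclideanSpace ℝ (Fin N) → ℂ) : ℝ≥0∞ :=
  ∑' q : ℤ, ENNReal.ofReal ((2:ℝ) ^ ((q : ℝ) * s)) * eLpNorm (lpBlock N q f) 2 volume

/-- Hybrid Besov norm `‖f‖_{B̃_μ^{s,r}} = Σ_q 2^{qs} max{μ,2^{-q}}^{1-2/r} ‖Δ̇_q f‖_{L²}`. -/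
noncomputable def hybridNorm (N : ℕ) (μ s r : ℝ) (f : EuclideanSpace ℝ (Fin N) → ℂ) : ℝ≥0∞ :=
  ∑' q : ℤ, ENNReal.ofReal ((2:ℝ) ^ ((q : ℝ) * s) * max μ ((2:ℝ) ^ (-q : ℤ)) ^ (1 - 2 / r)) *
    eLpNorm (lpBlock N q f) 2 volume

/-- Hybrid Besov norm with `r = ∞`: weight `max{μ, 2^{-q}}`. -/
noncomputable def hybridNormTop (N : ℕ) (μ s : ℝ) (f : EuclideanSpace ℝ (Fin N) → ℂ) : ℝ≥0∞ :=
  ∑' q : ℤ, ENNReal.ofReal ((2:ℝ) ^ ((q : ℝ) * s) * max μ ((2:ℝ) ^ (-q : ℤ))) *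
    eLpNorm (lpBlock N q f) 2 volume

/-- Hybrid Besov norm with `r = 1`: weight `max{μ, 2^{-q}}⁻¹`. -/
noncomputable def hybridNormBot (N : ℕ) (μ s : ℝ) (f : EuclideanSpace ℝ (Fin N) → ℂ) : ℝ≥0∞ :=
  ∑' q : ℤ, ENNReal.ofReal ((2:ℝ) ^ ((q : ℝ) * s) * (max μ ((2:ℝ) ^ (-q : ℤ)))⁻¹) *
    eLpNorm (lpBlock N q f) 2 volume

/-- Bony's homogeneous paraproduct `Ṫ_u v = Σ_q Ṡ_{q-1}u Δ̇_q v`. -/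
noncomputable def paraproduct (N : ℕ) (u v : EuclideanSpace ℝ (Fin N) → ℂ) :
    EuclideanSpace ℝ (Fin N) → ℂ :=
  fun x => ∑' q : ℤ, lowFreq N q u x * lpBlock N q v x

/-- Bony's homogeneous remainder `Ṙ(u,v) = Σ_{|p-q|≤1} Δ̇_p u Δ̇_q v`. -/
noncomputable def bonyRemainder (N : ℕ) (u v : EuclideanSpace ℝ (Fin N) → ℂ) :
    EuclideanSpace ℝ (Fin N) → ℂ :=
  fun x => ∑' q : ℤ,
    (lpBlock N (q - 1) u x + lpBlock N q u x + lpBlock N (q + 1) u x) * lpBlock N q v x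

section Fourier

variable {E : Type*} [NormedAddCommGroup E] [InnerProductSpace ℝ E] [FiniteDimensional ℝ E]
  [MeasurableSpace E] [BorelSpace E]

open scoped SchwartzMap Convolution

theorem integral_mul_fourier_eq {f : E → ℂ} (hf : Integrable f) (φ : 𝓢(E, ℂ)) :
    ∫ ξ, φ ξ * 𝓕 f ξ = ∫ x, (𝓕 φ) x * f x := by
  have h := VectorFourier.integral_fourierIntegral_smul_eq_flip (L := innerₗ E)
    continuous_fourierChar continuous_inner hf (φ.integrable (μ := volume))
  simp only [flip_innerₗ, smul_eq_mul] at h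
  simp only [mul_comm (φ _), mul_comm ((𝓕 φ) _)]
  exact h

theorem integral_mul_fourierInv_eq {f : E → ℂ} (hf : Integrable f) (φ : 𝓢(E, ℂ)) :
    ∫ x, (𝓕 φ) x * 𝓕⁻ f x = ∫ ξ, φ ξ * f ξ := by
  rw [fourierInv_eq_fourier_comp_neg, integral_mul_fourier_eq hf.comp_neg,
    ← integral_neg_eq_self (fun ξ => φ ξ * f ξ)]
  congr 1 with x
  have h : (𝓕 (𝓕 φ)) x = φ (-x) := by
    conv_rhs => rw [← FourierTransform.fourierInv_fourier_eq (F := 𝓢(E, ℂ)) φ]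
    rw [SchwartzMap.fourierInv_coe, fourierInv_eq_fourier_neg, neg_neg]
    rfl
  rw [h]

theorem integral_mul_fourier_toLp_eq {f : E → ℂ} (hf : MemLp f 2) (φ : 𝓢(E, ℂ)) :
    ∫ ξ, φ ξ * (𝓕 (hf.toLp f) : Lp ℂ 2 (volume : Measure E)) ξ = ∫ x, (𝓕 φ) x * f x := by
  have h := congrArg (fun T : 𝓢'(E, ℂ) => T φ) (Lp.fourier_toTemperedDistribution_eq (hf.toLp f))
  simp only [TemperedDistribution.fourier_apply, Lp.toTemperedDistribution_apply,
    smul_eq_mul] at h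
  rw [← h]
  refine integral_congr_ae ?_
  filter_upwards [hf.coeFn_toLp] with x hx
  rw [hx]

theorem eLpNorm_fourier_toLp {f : E → ℂ} (hf : MemLp f 2) :
    eLpNorm ⇑(𝓕 (hf.toLp f) : Lp ℂ 2 (volume : Measure E)) 2 volume = eLpNorm f 2 volume := by
  rw [← eLpNorm_congr_ae hf.coeFn_toLp, ← Lp.enorm_def, ← Lp.enorm_def, enorm_eq_iff_norm_eq]
  exact Lp.norm_fourier_eq _

theorem continuous_fourier {f : E → ℂ} (hf : Integrable f) : Continuous (𝓕 f) :=
  VectorFourier.fourierIntegral_continuous (L := innerₗ E)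
    continuous_fourierChar continuous_inner hf

/-- If, tested against Schwartz functions with frequency support in an open set `U`, an integrable
function `f` agrees with a square-integrable function `g`, then `𝓕 f` restricted to `U` is bounded
in `L²` by `g`. -/
theorem eLpNorm_indicator_fourier_le {f g : E → ℂ} {U : Set E} (hU : IsOpen U)
    (hf : Integrable f) (hg : MemLp g 2)
    (h : ∀ φ : 𝓢(E, ℂ), tsupport φ ⊆ U → ∫ x, (𝓕 φ) x * f x = ∫ x, (𝓕 φ) x * g x) :
    eLpNorm (U.indicator (𝓕 f)) 2 volume ≤ eLpNorm g 2 volume := by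
  set G : E → ℂ := ⇑(𝓕 (hg.toLp g) : Lp ℂ 2 (volume : Measure E)) with hG
  have hGloc : LocallyIntegrable G := (Lp.memLp _).locallyIntegrable one_le_two
  have hfloc : LocallyIntegrable (𝓕 f) := (continuous_fourier hf).locallyIntegrable
  have key : ∀ᵐ x, x ∈ U → (𝓕 f - G) x = 0 := by
    refine hU.ae_eq_zero_of_integral_contDiff_smul_eq_zero
      ((hfloc.sub hGloc).locallyIntegrableOn U) fun ψ hψ hψc hψU => ?_
    have hc : HasCompactSupport (Complex.ofRealCLM ∘ ψ) := hψc.comp_left rfl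
    have hs : ContDiff ℝ (⊤ : ℕ∞) (Complex.ofRealCLM ∘ ψ) := by fun_prop
    have hsub : tsupport (hc.toSchwartzMap hs) ⊆ U :=
      (closure_mono (Function.support_comp_subset (map_zero Complex.ofRealCLM) ψ)).trans hψU
    have h₁ := integral_mul_fourier_eq hf (hc.toSchwartzMap hs)
    have h₂ := integral_mul_fourier_toLp_eq hg (hc.toSchwartzMap hs)
    have h₃ := h _ hsub
    simp only [Pi.sub_apply, smul_sub]
    rw [integral_sub (hfloc.integrable_smul_left_of_hasCompactSupport hψ.continuous hψc)
      (hGloc.integrable_smul_left_of_hasCompactSupport hψ.continuous hψc), sub_eq_zero]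
    simpa [← hG] using h₁.trans (h₃.trans h₂.symm)
  rw [← eLpNorm_fourier_toLp hg]
  refine eLpNorm_mono_enorm_ae ?_
  filter_upwards [key] with x hx
  by_cases hxU : x ∈ U
  · rw [Set.indicator_of_mem hxU, sub_eq_zero.1 (hx hxU)]
  · simp [Set.indicator_of_notMem hxU]

theorem eLpNorm_fourier_eq {f : E → ℂ} (hf : Integrable f) (hf2 : MemLp f 2) :
    eLpNorm (𝓕 f) 2 volume = eLpNorm f 2 volume := by
  rw [← eLpNorm_fourier_toLp hf2]
  refine eLpNorm_congr_ae (ae_eq_of_integral_contDiff_smul_eq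
    (continuous_fourier hf).locallyIntegrable ((Lp.memLp _).locallyIntegrable one_le_two)
    fun ψ hψ hψc => ?_)
  have hc : HasCompactSupport (Complex.ofRealCLM ∘ ψ) := hψc.comp_left rfl
  have hs : ContDiff ℝ (⊤ : ℕ∞) (Complex.ofRealCLM ∘ ψ) := by fun_prop
  simpa using (integral_mul_fourier_eq hf (hc.toSchwartzMap hs)).trans
    (integral_mul_fourier_toLp_eq hf2 (hc.toSchwartzMap hs)).symm

theorem eLpNorm_fourierInv_eq {f : E → ℂ} (hf : Integrable f) (hf2 : MemLp f 2) :
    eLpNorm (𝓕⁻ f) 2 volume = eLpNorm f 2 volume := by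
  have hneg := Measure.measurePreserving_neg (volume : Measure E)
  rw [fourierInv_eq_fourier_comp_neg,
    eLpNorm_fourier_eq hf.comp_neg (hf2.comp_measurePreserving hneg)]
  exact eLpNorm_comp_measurePreserving hf2.1 hneg

theorem continuous_fourierInv {f : E → ℂ} (hf : Integrable f) : Continuous (𝓕⁻ f) := by
  rw [fourierInv_eq_fourier_comp_neg]
  exact continuous_fourier hf.comp_neg

theorem enorm_fourierInv_le (f : E → ℂ) (x : E) : ‖𝓕⁻ f x‖ₑ ≤ eLpNorm f 1 volume := by
  rw [fourierInv_eq, eLpNorm_one_eq_lintegral_enorm]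
  refine (enorm_integral_le_lintegral_enorm _).trans_eq ?_
  simp only [← ofReal_norm, Circle.norm_smul]

theorem norm_fourierInv_le (f : E → ℂ) (x : E) : ‖𝓕⁻ f x‖ ≤ ∫ ξ, ‖f ξ‖ := by
  rw [fourierInv_eq]
  refine (norm_integral_le_integral_norm _).trans_eq ?_
  simp

theorem fourierInv_mul_fourierInv {f g : E → ℂ} (hf : Integrable f) (hg : Integrable g) (x : E) :
    𝓕⁻ f x * 𝓕⁻ g x = 𝓕⁻ (f ⋆[ContinuousLinearMap.mul ℂ ℂ] g) x := by
  simp only [fourierInv_eq_fourier_neg]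
  exact (Real.fourier_mul_convolution_eq hf hg (-x)).symm

/-- The product of two functions has no frequencies outside the sum of the frequency supports. -/
theorem integral_fourier_mul_fourierInv_mul_eq_zero {f g : E → ℂ} (hf : Integrable f)
    (hg : Integrable g) (φ : 𝓢(E, ℂ))
    (h : ∀ ξ η, f ξ ≠ 0 → g η ≠ 0 → φ (ξ + η) = 0) :
    ∫ x, (𝓕 φ) x * (𝓕⁻ f x * 𝓕⁻ g x) = 0 := by
  simp only [fourierInv_mul_fourierInv hf hg]
  rw [integral_mul_fourierInv_eq (hf.integrable_convolution _ hg)]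
  refine integral_eq_zero_of_ae (Filter.Eventually.of_forall fun ζ => ?_)
  by_cases hζ : (f ⋆[ContinuousLinearMap.mul ℂ ℂ] g) ζ = 0
  · simp [hζ]
  · obtain ⟨ξ, hξ, η, hη, rfl⟩ := support_convolution_subset _ hζ
    simp [h ξ η hξ hη]

/-- The `L²` norm of `𝓕⁻ f * 𝓕⁻ g` is at most the `L¹` norm of `f` times the `L²` norm of `g`. -/
theorem eLpNorm_fourierInv_mul_fourierInv_le {f g : E → ℂ} (hg : Integrable g) (hg2 : MemLp g 2) :
    eLpNorm (fun x => 𝓕⁻ f x * 𝓕⁻ g x) 2 volume ≤ eLpNorm f 1 volume * eLpNorm g 2 volume := by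
  rw [← eLpNorm_fourierInv_eq hg hg2]
  refine eLpNorm_le_mul_eLpNorm_of_ae_le_mul'' _ ?_ (Filter.Eventually.of_forall fun x => ?_)
  · exact (continuous_fourierInv hg).aestronglyMeasurable
  · rw [enorm_mul]
    gcongr
    exact enorm_fourierInv_le f x

end Fourier

section Dyadic

/-- The dyadic annulus `2^q ≤ ‖ξ‖ < 2^(q+1)`. -/
def dyadicAnnulus (E : Type*) [Norm E] (q : ℤ) : Set E :=
  {ξ | (2:ℝ) ^ q ≤ ‖ξ‖ ∧ ‖ξ‖ < (2:ℝ) ^ (q + 1)}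

variable {E : Type*} [NormedAddCommGroup E]

theorem pairwise_disjoint_dyadicAnnulus : Pairwise (Function.onFun Disjoint (dyadicAnnulus E)) := by
  have key : ∀ p q : ℤ, p < q → Disjoint (dyadicAnnulus E p) (dyadicAnnulus E q) := by
    intro p q hpq
    refine Set.disjoint_left.2 fun ξ hp hq => ?_
    exact (hp.2.trans_le (zpow_le_zpow_right₀ one_le_two (by lia : p + 1 ≤ q))).not_ge hq.1
  intro p q hpq
  rcases hpq.lt_or_gt with h | h
  exacts [key p q h, (key q p h).symm]

theorem ball_subset_iUnion_dyadicAnnulus (q : ℤ) :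
    Metric.ball (0 : E) ((2:ℝ) ^ (q - 1)) ⊆
      {0} ∪ ⋃ p : Set.Iic (q - 2), dyadicAnnulus E p := by
  intro ξ hξ
  rw [mem_ball_zero_iff] at hξ
  rcases eq_or_ne ξ 0 with rfl | h0
  · exact Or.inl rfl
  · obtain ⟨p, hp⟩ := exists_mem_Ico_zpow (norm_pos_iff.2 h0) (_root_.one_lt_two (α := ℝ))
    have hpq : p < q - 1 := (zpow_lt_zpow_iff_right₀ _root_.one_lt_two).1 (hp.1.trans_lt hξ)
    exact Or.inr (Set.mem_iUnion.2 ⟨⟨p, by simp only [Set.mem_Iic]; lia⟩, hp⟩)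

theorem dyadicAnnulus_subset_ball (q : ℤ) :
    dyadicAnnulus E q ⊆ Metric.ball 0 ((2:ℝ) ^ (q + 1)) :=
  fun _ hξ => mem_ball_zero_iff.2 hξ.2

/-- The sum of a frequency of `Ṡ_{q-1}` and a frequency of `Δ̇_q` lies in the `j`-th open annulus
only if `|j - q| ≤ 1`. -/
theorem mem_Icc_of_add_mem_annulus {ξ η : E} {j q : ℤ} (hξ : ‖ξ‖ < (2:ℝ) ^ (q - 1))
    (hη : η ∈ dyadicAnnulus E q) (h₁ : (2:ℝ) ^ j < ‖ξ + η‖) (h₂ : ‖ξ + η‖ < (2:ℝ) ^ (j + 1)) :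
    q ∈ Finset.Icc (j - 1) (j + 1) := by
  have hq : (0:ℝ) < 2 ^ q := by positivity
  have e₁ : (2:ℝ) ^ (q - 1) = 2 ^ q / 2 := zpow_sub_one₀ two_ne_zero q
  have e₂ : (2:ℝ) ^ (q + 1) = 2 ^ q * 2 := zpow_add_one₀ two_ne_zero q
  have e₃ : (2:ℝ) ^ (q + 2) = 2 ^ q * 4 := by rw [zpow_add₀ two_ne_zero]; norm_num
  have hη₁ := hη.1
  have hη₂ := hη.2
  have lo : (2:ℝ) ^ (q - 1) < 2 ^ (j + 1) := by
    have := norm_sub_le (ξ + η) ξ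
    rw [add_sub_cancel_left] at this
    linarith
  have hi : (2:ℝ) ^ j < 2 ^ (q + 2) := by
    have := norm_add_le ξ η
    linarith
  have lo' := (zpow_lt_zpow_iff_right₀ _root_.one_lt_two).1 lo
  have hi' := (zpow_lt_zpow_iff_right₀ _root_.one_lt_two).1 hi
  rw [Finset.mem_Icc]
  lia

variable [MeasurableSpace E] [BorelSpace E]

theorem measurableSet_dyadicAnnulus (q : ℤ) : MeasurableSet (dyadicAnnulus E q) :=
  (measurableSet_le measurable_const measurable_norm).inter
    (measurableSet_lt measurable_norm measurable_const)

variable [InnerProductSpace ℝ E] [FiniteDimensional ℝ E]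

theorem volume_dyadicAnnulus_lt_top (q : ℤ) : volume (dyadicAnnulus E q) < ∞ :=
  (measure_mono (dyadicAnnulus_subset_ball q)).trans_lt measure_ball_lt_top

theorem volume_dyadicAnnulus_rpow_le (q : ℤ) :
    volume (dyadicAnnulus E q) ^ (1 / 2 : ℝ) ≤
      ENNReal.ofReal ((2:ℝ) ^ (((q : ℝ) + 1) * (Module.finrank ℝ E / 2))) *
        volume (Metric.ball (0 : E) 1) ^ (1 / 2 : ℝ) := by
  have h : volume (dyadicAnnulus E q) ≤
      ENNReal.ofReal (((2:ℝ) ^ (q + 1)) ^ Module.finrank ℝ E) * volume (Metric.ball (0 : E) 1) := by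
    rw [← Measure.addHaar_ball_of_pos volume (0 : E) (by positivity)]
    exact measure_mono (dyadicAnnulus_subset_ball q)
  refine (ENNReal.rpow_le_rpow h (by norm_num)).trans_eq ?_
  rw [ENNReal.mul_rpow_of_nonneg _ _ (by norm_num),
    ENNReal.ofReal_rpow_of_nonneg (by positivity) (by norm_num)]
  congr 2
  rw [← Real.rpow_intCast, ← Real.rpow_natCast, ← Real.rpow_mul (by positivity),
    ← Real.rpow_mul (by positivity)]
  push_cast
  ring_nf

theorem eLpNorm_one_indicator_le {h : E → ℂ} {s : Set E} (hs : MeasurableSet s)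
    (hh : AEStronglyMeasurable h) :
    eLpNorm (s.indicator h) 1 volume ≤
      eLpNorm (s.indicator h) 2 volume * volume s ^ (1 / 2 : ℝ) := by
  rw [eLpNorm_indicator_eq_eLpNorm_restrict hs, eLpNorm_indicator_eq_eLpNorm_restrict hs]
  refine (eLpNorm_le_eLpNorm_mul_rpow_measure_univ one_le_two hh.restrict).trans_eq ?_
  rw [Measure.restrict_apply_univ]
  norm_num

theorem eLpNorm_one_indicator_ball_le [Nontrivial E] {h : E → ℂ} (hh : AEStronglyMeasurable h)
    (q : ℤ) :
    eLpNorm ((Metric.ball (0 : E) ((2:ℝ) ^ (q - 1))).indicator h) 1 volume ≤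
      ∑' p : Set.Iic (q - 2), eLpNorm ((dyadicAnnulus E p).indicator h) 2 volume *
        volume (dyadicAnnulus E (p : ℤ)) ^ (1 / 2 : ℝ) := by
  rw [eLpNorm_indicator_eq_eLpNorm_restrict measurableSet_ball, eLpNorm_one_eq_lintegral_enorm]
  calc ∫⁻ ξ in Metric.ball (0 : E) ((2:ℝ) ^ (q - 1)), ‖h ξ‖ₑ
      ≤ ∫⁻ ξ in {0} ∪ ⋃ p : Set.Iic (q - 2), dyadicAnnulus E p, ‖h ξ‖ₑ :=
        lintegral_mono_set (ball_subset_iUnion_dyadicAnnulus q)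
    _ ≤ (∫⁻ ξ in {0}, ‖h ξ‖ₑ) + ∫⁻ ξ in ⋃ p : Set.Iic (q - 2), dyadicAnnulus E p, ‖h ξ‖ₑ :=
        lintegral_union_le _ _ _
    _ = ∫⁻ ξ in ⋃ p : Set.Iic (q - 2), dyadicAnnulus E p, ‖h ξ‖ₑ := by
        rw [Measure.restrict_singleton, measure_singleton, zero_smul, lintegral_zero_measure,
          zero_add]
    _ ≤ ∑' p : Set.Iic (q - 2), ∫⁻ ξ in dyadicAnnulus E p, ‖h ξ‖ₑ := lintegral_iUnion_le _ _
    _ ≤ _ := by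
        refine ENNReal.tsum_le_tsum fun p => ?_
        rw [← eLpNorm_one_eq_lintegral_enorm,
          ← eLpNorm_indicator_eq_eLpNorm_restrict (measurableSet_dyadicAnnulus _)]
        exact eLpNorm_one_indicator_le (measurableSet_dyadicAnnulus _) hh

theorem memLp_indicator_fourier {f : E → ℂ} (hf : Integrable f) {s : Set E}
    (hs : MeasurableSet s) (hs' : volume s < ∞) (p : ℝ≥0∞) : MemLp (s.indicator (𝓕 f)) p := by
  rw [memLp_indicator_iff_restrict hs]
  have : IsFiniteMeasure (volume.restrict s) := ⟨by rwa [Measure.restrict_apply_univ]⟩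
  exact MemLp.of_bound (continuous_fourier hf).aestronglyMeasurable (∫ x, ‖f x‖)
    (Filter.Eventually.of_forall fun ξ =>
      VectorFourier.norm_fourierIntegral_le_integral_norm _ _ _ _ _)

end Dyadic

section LittlewoodPaley

variable {N : ℕ} {f : EuclideanSpace ℝ (Fin N) → ℂ}

theorem lpBlock_eq (q : ℤ) :
    lpBlock N q f = 𝓕⁻ ((dyadicAnnulus (EuclideanSpace ℝ (Fin N)) q).indicator (𝓕 f)) := by
  unfold lpBlock
  refine congrArg _ (funext fun ξ => ?_)
  by_cases h : ξ ∈ dyadicAnnulus (EuclideanSpace ℝ (Fin N)) q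
  · rw [Set.indicator_of_mem h]
    exact if_pos h
  · rw [Set.indicator_of_notMem h]
    exact if_neg h

theorem lowFreq_eq (q : ℤ) :
    lowFreq N q f =
      𝓕⁻ ((Metric.ball (0 : EuclideanSpace ℝ (Fin N)) ((2:ℝ) ^ (q - 1))).indicator (𝓕 f)) := by
  unfold lowFreq
  refine congrArg _ (funext fun ξ => ?_)
  simp [Set.indicator]

theorem eLpNorm_lpBlock (hf : Integrable f) (q : ℤ) :
    eLpNorm (lpBlock N q f) 2 volume =
      eLpNorm ((dyadicAnnulus (EuclideanSpace ℝ (Fin N)) q).indicator (𝓕 f)) 2 volume := by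
  have h := memLp_indicator_fourier hf (measurableSet_dyadicAnnulus q)
    (volume_dyadicAnnulus_lt_top q)
  rw [lpBlock_eq, eLpNorm_fourierInv_eq (memLp_one_iff_integrable.1 (h 1)) (h 2)]

theorem lpBlock_eq_zero_of_not_integrable (hf : ¬ Integrable f) (q : ℤ) : lpBlock N q f = 0 := by
  have h : 𝓕 f = 0 := by
    ext ξ
    rw [fourier_eq]
    exact integral_undef (by rwa [fourierIntegral_convergent_iff])
  rw [lpBlock_eq, h, Set.indicator_zero']
  ext x
  simp [fourierInv_eq]

theorem lpBlock_dim_zero (f : EuclideanSpace ℝ (Fin 0) → ℂ) (q : ℤ) : lpBlock 0 q f = 0 := by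
  have h : dyadicAnnulus (EuclideanSpace ℝ (Fin 0)) q = ∅ := by
    refine Set.eq_empty_of_forall_notMem fun ξ hξ => ?_
    have := hξ.1
    rw [Subsingleton.elim ξ 0, norm_zero] at this
    exact this.not_gt (by positivity)
  rw [lpBlock_eq, h, Set.indicator_empty']
  ext x
  simp [fourierInv_eq]

end LittlewoodPaley

section Paraproduct

open scoped SchwartzMap

variable {N : ℕ}

theorem memLp_lpBlock_freq (v : 𝓢(EuclideanSpace ℝ (Fin N), ℂ)) (q : ℤ) (p : ℝ≥0∞) :
    MemLp ((dyadicAnnulus (EuclideanSpace ℝ (Fin N)) q).indicator (𝓕 (v : _ → ℂ))) p :=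
  memLp_indicator_fourier v.integrable (measurableSet_dyadicAnnulus q)
    (volume_dyadicAnnulus_lt_top q) p

theorem memLp_lowFreq_freq (u : 𝓢(EuclideanSpace ℝ (Fin N), ℂ)) (q : ℤ) (p : ℝ≥0∞) :
    MemLp ((Metric.ball (0 : EuclideanSpace ℝ (Fin N)) ((2:ℝ) ^ (q - 1))).indicator
      (𝓕 (u : _ → ℂ))) p :=
  memLp_indicator_fourier u.integrable measurableSet_ball measure_ball_lt_top p

theorem continuous_lowFreq_mul_lpBlock (u v : 𝓢(EuclideanSpace ℝ (Fin N), ℂ)) (q : ℤ) :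
    Continuous fun x => lowFreq N q u x * lpBlock N q v x := by
  rw [lowFreq_eq, lpBlock_eq]
  exact (continuous_fourierInv (memLp_one_iff_integrable.1 (memLp_lowFreq_freq u q 1))).mul
    (continuous_fourierInv (memLp_one_iff_integrable.1 (memLp_lpBlock_freq v q 1)))

theorem eLpNorm_lowFreq_mul_lpBlock_le (u v : 𝓢(EuclideanSpace ℝ (Fin N), ℂ)) (q : ℤ) :
    eLpNorm (fun x => lowFreq N q u x * lpBlock N q v x) 2 volume ≤
      eLpNorm ((Metric.ball (0 : EuclideanSpace ℝ (Fin N)) ((2:ℝ) ^ (q - 1))).indicator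
        (𝓕 (u : _ → ℂ))) 1 volume * eLpNorm (lpBlock N q v) 2 volume := by
  rw [lowFreq_eq, eLpNorm_lpBlock v.integrable, lpBlock_eq]
  exact eLpNorm_fourierInv_mul_fourierInv_le
    (memLp_one_iff_integrable.1 (memLp_lpBlock_freq v q 1)) (memLp_lpBlock_freq v q 2)

theorem memLp_lowFreq_mul_lpBlock (u v : 𝓢(EuclideanSpace ℝ (Fin N), ℂ)) (q : ℤ) :
    MemLp (fun x => lowFreq N q u x * lpBlock N q v x) 2 := by
  refine ⟨(continuous_lowFreq_mul_lpBlock u v q).aestronglyMeasurable,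
    (eLpNorm_lowFreq_mul_lpBlock_le u v q).trans_lt ?_⟩
  rw [eLpNorm_lpBlock v.integrable]
  exact ENNReal.mul_lt_top (memLp_lowFreq_freq u q 1).2 (memLp_lpBlock_freq v q 2).2

theorem norm_lowFreq_mul_lpBlock_le (u v : 𝓢(EuclideanSpace ℝ (Fin N), ℂ)) (q : ℤ)
    (x : EuclideanSpace ℝ (Fin N)) :
    ‖lowFreq N q u x * lpBlock N q v x‖ ≤
      (∫ ξ, ‖𝓕 (u : _ → ℂ) ξ‖) * ∫ ξ in dyadicAnnulus _ q, ‖𝓕 (v : _ → ℂ) ξ‖ := by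
  rw [norm_mul]
  refine mul_le_mul ?_ ?_ (norm_nonneg _) (integral_nonneg fun _ => norm_nonneg _)
  · rw [lowFreq_eq]
    refine (norm_fourierInv_le _ x).trans ?_
    refine integral_mono_of_nonneg (Filter.Eventually.of_forall fun _ => norm_nonneg _)
      (𝓕 u).integrable.norm (Filter.Eventually.of_forall fun ξ => ?_)
    exact norm_indicator_le_norm_self _ _
  · rw [lpBlock_eq]
    refine (norm_fourierInv_le _ x).trans_eq ?_
    simp only [norm_indicator_eq_indicator_norm]
    exact integral_indicator (measurableSet_dyadicAnnulus q)

theorem summable_integral_dyadicAnnulus (v : 𝓢(EuclideanSpace ℝ (Fin N), ℂ)) :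
    Summable fun q : ℤ => ∫ ξ in dyadicAnnulus _ q, ‖𝓕 (v : _ → ℂ) ξ‖ :=
  (hasSum_integral_iUnion (fun q => measurableSet_dyadicAnnulus q)
    pairwise_disjoint_dyadicAnnulus (𝓕 v).integrable.norm.integrableOn).summable

theorem integrable_mul_lowFreq_mul_lpBlock (u v ψ : 𝓢(EuclideanSpace ℝ (Fin N), ℂ)) (q : ℤ) :
    Integrable fun x => ψ x * (lowFreq N q u x * lpBlock N q v x) :=
  ψ.integrable.mul_bdd (continuous_lowFreq_mul_lpBlock u v q).aestronglyMeasurable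
    (Filter.Eventually.of_forall (norm_lowFreq_mul_lpBlock_le u v q))

theorem hasSum_integral_mul_paraproduct (u v ψ : 𝓢(EuclideanSpace ℝ (Fin N), ℂ)) :
    HasSum (fun q : ℤ => ∫ x, ψ x * (lowFreq N q u x * lpBlock N q v x))
      (∫ x, ψ x * paraproduct N u v x) := by
  have h := hasSum_integral_of_summable_integral_norm
    (integrable_mul_lowFreq_mul_lpBlock u v ψ) ?_
  · simp only [tsum_mul_left] at h
    exact h
  · refine Summable.of_nonneg_of_le (fun q => integral_nonneg fun _ => norm_nonneg _) (fun q => ?_)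
      ((summable_integral_dyadicAnnulus v).mul_left
        ((∫ x, ‖ψ x‖) * ∫ ξ, ‖𝓕 (u : _ → ℂ) ξ‖))
    rw [mul_assoc, ← integral_mul_const]
    refine integral_mono_of_nonneg (Filter.Eventually.of_forall fun _ => norm_nonneg _)
      (ψ.integrable.norm.mul_const _) (Filter.Eventually.of_forall fun x => ?_)
    simp only [norm_mul (ψ x)]
    exact mul_le_mul_of_nonneg_left (norm_lowFreq_mul_lpBlock_le u v q x) (norm_nonneg _)

/-- Only the three terms with `|q - j| ≤ 1` contribute to `Δ̇_j` of the paraproduct. -/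
theorem integral_mul_paraproduct_eq (u v φ : 𝓢(EuclideanSpace ℝ (Fin N), ℂ)) (j : ℤ)
    (hφ : tsupport φ ⊆ {ξ | (2:ℝ) ^ j < ‖ξ‖ ∧ ‖ξ‖ < (2:ℝ) ^ (j + 1)}) :
    ∫ x, (𝓕 φ) x * paraproduct N u v x =
      ∫ x, (𝓕 φ) x * ∑ q ∈ Finset.Icc (j - 1) (j + 1), lowFreq N q u x * lpBlock N q v x := by
  simp only [Finset.mul_sum]
  rw [integral_finsetSum _ fun q _ => integrable_mul_lowFreq_mul_lpBlock u v (𝓕 φ) q,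
    ← (hasSum_integral_mul_paraproduct u v (𝓕 φ)).tsum_eq]
  refine tsum_eq_sum fun q hq => ?_
  rw [lowFreq_eq, lpBlock_eq]
  refine integral_fourier_mul_fourierInv_mul_eq_zero
    (memLp_one_iff_integrable.1 (memLp_lowFreq_freq u q 1))
    (memLp_one_iff_integrable.1 (memLp_lpBlock_freq v q 1)) φ fun ξ η hξ hη => ?_
  by_contra h
  have hU := hφ (subset_tsupport _ h)
  exact hq (mem_Icc_of_add_mem_annulus
    (mem_ball_zero_iff.1 (Set.mem_of_indicator_ne_zero hξ)) (Set.mem_of_indicator_ne_zero hη)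
    hU.1 hU.2)

theorem eLpNorm_lpBlock_paraproduct_le (u v : 𝓢(EuclideanSpace ℝ (Fin N), ℂ)) (j : ℤ) :
    eLpNorm (lpBlock N j (paraproduct N u v)) 2 volume ≤
      ∑ q ∈ Finset.Icc (j - 1) (j + 1),
        eLpNorm ((Metric.ball (0 : EuclideanSpace ℝ (Fin N)) ((2:ℝ) ^ (q - 1))).indicator
          (𝓕 (u : _ → ℂ))) 1 volume * eLpNorm (lpBlock N q v) 2 volume := by
  by_cases hP : Integrable (paraproduct N u v)
  swap
  · rw [lpBlock_eq_zero_of_not_integrable hP, eLpNorm_zero]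
    exact zero_le
  set U : Set (EuclideanSpace ℝ (Fin N)) := {ξ | (2:ℝ) ^ j < ‖ξ‖ ∧ ‖ξ‖ < (2:ℝ) ^ (j + 1)}
  have hU : IsOpen U :=
    (isOpen_lt continuous_const continuous_norm).inter (isOpen_lt continuous_norm continuous_const)
  have hAU : (dyadicAnnulus (EuclideanSpace ℝ (Fin N)) j).indicator (𝓕 (paraproduct N u v))
      =ᵐ[volume] U.indicator (𝓕 (paraproduct N u v)) := by
    have hS : ∀ᵐ ξ : EuclideanSpace ℝ (Fin N), ξ ∉ Metric.sphere 0 ((2:ℝ) ^ j) :=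
      measure_eq_zero_iff_ae_notMem.1
        (Measure.addHaar_sphere_of_ne_zero volume 0 (by positivity))
    filter_upwards [hS] with ξ hξ
    have hne : (2:ℝ) ^ j ≠ ‖ξ‖ := fun h => hξ (mem_sphere_zero_iff_norm.2 h.symm)
    have hiff : ξ ∈ dyadicAnnulus (EuclideanSpace ℝ (Fin N)) j ↔ ξ ∈ U :=
      and_congr_left fun _ => ⟨fun h => lt_of_le_of_ne h hne, le_of_lt⟩
    by_cases h : ξ ∈ U
    · rw [Set.indicator_of_mem h, Set.indicator_of_mem (hiff.2 h)]
    · rw [Set.indicator_of_notMem h, Set.indicator_of_notMem (hiff.not.2 h)]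
  rw [eLpNorm_lpBlock hP, eLpNorm_congr_ae hAU]
  calc eLpNorm (U.indicator (𝓕 (paraproduct N u v))) 2 volume
      ≤ eLpNorm (fun x => ∑ q ∈ Finset.Icc (j - 1) (j + 1), lowFreq N q u x * lpBlock N q v x)
          2 volume :=
        eLpNorm_indicator_fourier_le hU hP
          (memLp_finsetSum _ fun q _ => memLp_lowFreq_mul_lpBlock u v q)
          fun φ hφ => integral_mul_paraproduct_eq u v φ j hφ
    _ ≤ ∑ q ∈ Finset.Icc (j - 1) (j + 1),
          eLpNorm (fun x => lowFreq N q u x * lpBlock N q v x) 2 volume := by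
        convert eLpNorm_sum_le (fun q _ => (memLp_lowFreq_mul_lpBlock u v q).1) one_le_two
          using 2
        ext x
        simp
    _ ≤ _ := Finset.sum_le_sum fun q _ => eLpNorm_lowFreq_mul_lpBlock_le u v q

end Paraproduct

section Weights

theorem zpow_mul_max_le {μ : ℝ} (hμ : 0 < μ) {p q : ℤ} (hpq : p ≤ q) :
    (2:ℝ) ^ (p - q) * max μ ((2:ℝ) ^ (-p)) ≤ max μ ((2:ℝ) ^ (-q)) := by
  rw [mul_max_of_nonneg _ _ (by positivity)]
  refine max_le_max ?_ ?_
  · exact mul_le_of_le_one_left hμ.le (zpow_le_one_of_nonpos₀ _root_.one_le_two (by lia))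
  · rw [← zpow_add₀ two_ne_zero]
    exact le_of_eq (by ring_nf)

theorem paraproduct_weight_le {d s t μ : ℝ} (hs : s ≤ d - 1) (hμ : 0 < μ) {p q : ℤ}
    (hpq : p ≤ q) :
    (2:ℝ) ^ ((q : ℝ) * (s + t - d)) * (2:ℝ) ^ (((p : ℝ) + 1) * d) ≤
      (2:ℝ) ^ d * ((2:ℝ) ^ ((q : ℝ) * t) * max μ ((2:ℝ) ^ (-q))) *
        ((2:ℝ) ^ ((p : ℝ) * s) * (max μ ((2:ℝ) ^ (-p)))⁻¹) := by
  have hM : 0 < max μ ((2:ℝ) ^ (-p)) := lt_max_of_lt_left hμ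
  have hpq' : (p : ℝ) - q ≤ 0 := by
    rw [sub_nonpos]
    exact_mod_cast hpq
  have key : (2:ℝ) ^ (((p : ℝ) - q) * (d - s)) ≤
      max μ ((2:ℝ) ^ (-q)) * (max μ ((2:ℝ) ^ (-p)))⁻¹ := by
    rw [← div_eq_mul_inv, le_div_iff₀ hM]
    refine le_trans ?_ (zpow_mul_max_le hμ hpq)
    gcongr
    rw [← Real.rpow_intCast]
    refine Real.rpow_le_rpow_of_exponent_le _root_.one_le_two ?_
    push_cast
    nlinarith
  calc (2:ℝ) ^ ((q : ℝ) * (s + t - d)) * (2:ℝ) ^ (((p : ℝ) + 1) * d)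
      = (2:ℝ) ^ d * (2:ℝ) ^ ((q : ℝ) * t) * (2:ℝ) ^ ((p : ℝ) * s) *
          (2:ℝ) ^ (((p : ℝ) - q) * (d - s)) := by
        simp only [← Real.rpow_add two_pos]
        ring_nf
    _ ≤ (2:ℝ) ^ d * (2:ℝ) ^ ((q : ℝ) * t) * (2:ℝ) ^ ((p : ℝ) * s) *
          (max μ ((2:ℝ) ^ (-q)) * (max μ ((2:ℝ) ^ (-p)))⁻¹) := by gcongr
    _ = _ := by ring

/-- A weighted `ℓ¹` norm of a three-term moving sum is controlled by that of the sequence. -/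
theorem tsum_weight_mul_sum_Icc_le (σ : ℝ) (Y : ℤ → ℝ≥0∞) :
    ∑' j : ℤ, ENNReal.ofReal ((2:ℝ) ^ ((j : ℝ) * σ)) * ∑ q ∈ Finset.Icc (j - 1) (j + 1), Y q ≤
      ENNReal.ofReal (3 * (2:ℝ) ^ |σ|) *
        ∑' q : ℤ, ENNReal.ofReal ((2:ℝ) ^ ((q : ℝ) * σ)) * Y q := by
  set W : ℤ → ℝ≥0∞ := fun q => ENNReal.ofReal ((2:ℝ) ^ ((q : ℝ) * σ)) * Y q
  have hterm : ∀ j : ℤ, ∀ k ∈ Finset.Icc (-1 : ℤ) 1,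
      ENNReal.ofReal ((2:ℝ) ^ ((j : ℝ) * σ)) * Y (k + j) ≤
        ENNReal.ofReal ((2:ℝ) ^ |σ|) * W (k + j) := by
    intro j k hk
    rw [Finset.mem_Icc] at hk
    have hk' : |(k : ℝ)| ≤ 1 := abs_le.2 ⟨by exact_mod_cast hk.1, by exact_mod_cast hk.2⟩
    rw [← mul_assoc, ← ENNReal.ofReal_mul (by positivity), ← Real.rpow_add two_pos]
    gcongr
    · exact _root_.one_le_two
    · have h₁ : -(k * σ) ≤ |σ| :=
        (neg_le_abs _).trans ((abs_mul _ _).trans_le (mul_le_of_le_one_left (abs_nonneg _) hk'))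
      push_cast
      linarith
  have himg : ∀ j : ℤ, ∑ q ∈ Finset.Icc (j - 1) (j + 1), Y q =
      ∑ k ∈ Finset.Icc (-1 : ℤ) 1, Y (k + j) := by
    intro j
    have h := Finset.sum_map (Finset.Icc (-1 : ℤ) 1) (addRightEmbedding j) Y
    rw [Finset.map_add_right_Icc] at h
    rw [sub_eq_neg_add, add_comm j 1]
    exact h
  calc ∑' j : ℤ, ENNReal.ofReal ((2:ℝ) ^ ((j : ℝ) * σ)) * ∑ q ∈ Finset.Icc (j - 1) (j + 1), Y q
      ≤ ∑' j : ℤ, ∑ k ∈ Finset.Icc (-1 : ℤ) 1, ENNReal.ofReal ((2:ℝ) ^ |σ|) * W (k + j) := by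
        refine ENNReal.tsum_le_tsum fun j => ?_
        rw [himg, Finset.mul_sum]
        exact Finset.sum_le_sum (hterm j)
    _ = ∑ k ∈ Finset.Icc (-1 : ℤ) 1, ENNReal.ofReal ((2:ℝ) ^ |σ|) * ∑' q, W q := by
        rw [Summable.tsum_finsetSum fun _ _ => ENNReal.summable]
        refine Finset.sum_congr rfl fun k _ => ?_
        rw [ENNReal.tsum_mul_left, ← (Equiv.addLeft k).tsum_eq W]
        rfl
    _ = _ := by
        have hcard : (Finset.Icc (-1 : ℤ) 1).card = 3 := rfl
        rw [Finset.sum_const, hcard, nsmul_eq_mul, ENNReal.ofReal_mul (by norm_num), mul_assoc]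
        norm_num

end Weights

/-- Paraproduct estimate in hybrid Besov spaces: for `s ≤ N/2 - 1` and `μ > 0`,
`‖Ṫ_u v‖_{Ḃ^{s+t-N/2}_{2,1}} ≤ C ‖u‖_{B̃_μ^{s,1}} ‖v‖_{B̃_μ^{t,∞}}`. -/
theorem paraproduct_estimate_bot_top (N : ℕ) (s t μ : ℝ) (hs : s ≤ N / 2 - 1) (hμ : 0 < μ) :
    ∃ C : ℝ, 0 < C ∧
      ∀ u v : SchwartzMap (EuclideanSpace ℝ (Fin N)) ℂ,
        besovNorm N (s + t - N / 2) (paraproduct N ⇑u ⇑v) ≤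
          ENNReal.ofReal C * hybridNormBot N μ s ⇑u * hybridNormTop N μ t ⇑v := by
  rcases N.eq_zero_or_pos with rfl | hN
  · refine ⟨1, one_pos, fun u v => ?_⟩
    simp [besovNorm, lpBlock_dim_zero]
  have : Nonempty (Fin N) := ⟨⟨0, hN⟩⟩
  set κ : ℝ≥0∞ := volume (Metric.ball (0 : EuclideanSpace ℝ (Fin N)) 1) ^ (1 / 2 : ℝ)
  have hκ_top : κ ≠ ∞ := ENNReal.rpow_ne_top_of_nonneg (by norm_num) measure_ball_lt_top.ne
  have hκ_zero : κ ≠ 0 := fun h => (Metric.measure_ball_pos volume _ one_pos).ne'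
    ((ENNReal.rpow_eq_zero_iff_of_pos (by norm_num)).1 h)
  set σ : ℝ := s + t - N / 2
  refine ⟨3 * (2:ℝ) ^ |σ| * (κ.toReal * (2:ℝ) ^ ((N : ℝ) / 2)), ?_, fun u v => ?_⟩
  · have := ENNReal.toReal_pos hκ_zero hκ_top
    positivity
  have hlow : ∀ q : ℤ, eLpNorm ((Metric.ball (0 : EuclideanSpace ℝ (Fin N))
      ((2:ℝ) ^ (q - 1))).indicator (𝓕 (u : _ → ℂ))) 1 volume ≤
      ∑' p : Set.Iic (q - 2), eLpNorm (lpBlock N p u) 2 volume *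
        (ENNReal.ofReal ((2:ℝ) ^ (((p : ℤ) + 1 : ℝ) * (N / 2))) * κ) := by
    intro q
    refine (eLpNorm_one_indicator_ball_le
      (continuous_fourier u.integrable).aestronglyMeasurable q).trans
      (ENNReal.tsum_le_tsum fun p => ?_)
    rw [eLpNorm_lpBlock u.integrable]
    gcongr
    have h := volume_dyadicAnnulus_rpow_le (E := EuclideanSpace ℝ (Fin N)) (p : ℤ)
    rwa [finrank_euclideanSpace_fin] at h
  have hblock : ∀ q : ℤ, ENNReal.ofReal ((2:ℝ) ^ ((q : ℝ) * σ)) *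
      (eLpNorm ((Metric.ball (0 : EuclideanSpace ℝ (Fin N)) ((2:ℝ) ^ (q - 1))).indicator
        (𝓕 (u : _ → ℂ))) 1 volume * eLpNorm (lpBlock N q v) 2 volume) ≤
      κ * ENNReal.ofReal ((2:ℝ) ^ ((N : ℝ) / 2)) * hybridNormBot N μ s u *
        (ENNReal.ofReal ((2:ℝ) ^ ((q : ℝ) * t) * max μ ((2:ℝ) ^ (-q : ℤ))) *
          eLpNorm (lpBlock N q v) 2 volume) := by
    intro q
    have h : ENNReal.ofReal ((2:ℝ) ^ ((q : ℝ) * σ)) *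
        eLpNorm ((Metric.ball (0 : EuclideanSpace ℝ (Fin N)) ((2:ℝ) ^ (q - 1))).indicator
          (𝓕 (u : _ → ℂ))) 1 volume ≤
        κ * ENNReal.ofReal ((2:ℝ) ^ ((N : ℝ) / 2)) *
          ENNReal.ofReal ((2:ℝ) ^ ((q : ℝ) * t) * max μ ((2:ℝ) ^ (-q : ℤ))) *
            hybridNormBot N μ s u := by
      refine (mul_le_mul_right (hlow q) _).trans ?_
      rw [hybridNormBot, ← ENNReal.tsum_mul_left, ← ENNReal.tsum_mul_left]
      refine le_trans (ENNReal.tsum_le_tsum fun p => ?_)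
        (ENNReal.tsum_comp_le_tsum_of_injective (f := ((↑) : Set.Iic (q - 2) → ℤ))
          Subtype.val_injective _)
      have hpq : (p : ℤ) ≤ q := by
        have := p.2
        simp only [Set.mem_Iic] at this
        lia
      have hw := ENNReal.ofReal_le_ofReal (paraproduct_weight_le (t := t) hs hμ hpq)
      have hM : 0 ≤ max μ ((2:ℝ) ^ (-q : ℤ)) := hμ.le.trans (le_max_left _ _)
      rw [ENNReal.ofReal_mul (by positivity), ENNReal.ofReal_mul (by positivity),
        ENNReal.ofReal_mul (by positivity)] at hw
      calc _ = κ * (ENNReal.ofReal ((2:ℝ) ^ ((q : ℝ) * σ)) *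
              ENNReal.ofReal ((2:ℝ) ^ (((p : ℤ) + 1 : ℝ) * (N / 2)))) *
                eLpNorm (lpBlock N p u) 2 volume := by ring
        _ ≤ _ := by
          refine (mul_le_mul_left (mul_le_mul_right hw κ) _).trans_eq ?_
          ring
    rw [← mul_assoc]
    refine (mul_le_mul_left h _).trans_eq ?_
    ring
  calc besovNorm N σ (paraproduct N u v)
      ≤ ∑' j : ℤ, ENNReal.ofReal ((2:ℝ) ^ ((j : ℝ) * σ)) *
          ∑ q ∈ Finset.Icc (j - 1) (j + 1),
            eLpNorm ((Metric.ball (0 : EuclideanSpace ℝ (Fin N)) ((2:ℝ) ^ (q - 1))).indicator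
              (𝓕 (u : _ → ℂ))) 1 volume * eLpNorm (lpBlock N q v) 2 volume :=
        ENNReal.tsum_le_tsum fun j =>
          mul_le_mul_right (eLpNorm_lpBlock_paraproduct_le u v j) _
    _ ≤ _ := tsum_weight_mul_sum_Icc_le σ _
    _ ≤ ENNReal.ofReal (3 * (2:ℝ) ^ |σ|) * (κ * ENNReal.ofReal ((2:ℝ) ^ ((N : ℝ) / 2)) *
          hybridNormBot N μ s u * hybridNormTop N μ t v) := by
        rw [hybridNormTop, ← ENNReal.tsum_mul_left (a := κ * _ * _)]
        exact mul_le_mul_right (ENNReal.tsum_le_tsum hblock) _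
    _ = _ := by
        rw [ENNReal.ofReal_mul (p := 3 * (2:ℝ) ^ |σ|) (by positivity),
          ENNReal.ofReal_mul ENNReal.toReal_nonneg, ENNReal.ofReal_toReal hκ_top]
        ring
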